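/- If M is a compact Hausdorff MT-algebra, then the closed elements of M coincide with the compact elements of M, i.e., C(M) = K(M). (In particular, in any compact MT-algebra every closed element is compact.) -/

import Mathlib

/-- An MT-algebra: a complete Boolean algebra with an interior operator. -/
structure MTAlg (M : Type*) [CompleteBooleanAlgebra M] where
  box : M → M
  box_top : box ⊤ = ⊤
  box_inf : ∀ a b : M, box (a ⊓ b) = box a ⊓ box b
  box_le : ∀ a : M, box a ≤ a
  box_idem : ∀ a : M, box a ≤ box (box a)

namespace MTAlg

variable {M : Type*} [CompleteBooleanAlgebra M] (T : MTAlg M)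

/-- The closure (dual) operator. -/
def dia (a : M) : M := (T.box aᶜ)ᶜ

/-- Open elements. -/
def IsOpenElem (a : M) : Prop := T.box a = a

/-- Closed elements. -/
def IsClosedElem (a : M) : Prop := T.dia a = a

/-- Saturated elements: meets of open elements. -/
def IsSaturatedElem (a : M) : Prop :=
  ∃ S : Set M, (∀ s ∈ S, T.IsOpenElem s) ∧ a = sInf S

/-- Weakly locally closed elements: meets of a saturated and a closed element. -/
def IsWLC (a : M) : Prop :=
  ∃ s c : M, T.IsSaturatedElem s ∧ T.IsClosedElem c ∧ a = s ⊓ c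

/-- T0-algebras: every element is a join of weakly locally closed elements. -/
def IsT0 : Prop :=
  ∀ a : M, ∃ S : Set M, (∀ b ∈ S, T.IsWLC b) ∧ a = sSup S

/-- T1-algebras: every element is a join of closed elements. -/
def IsT1 : Prop :=
  ∀ a : M, ∃ S : Set M, (∀ b ∈ S, T.IsClosedElem b) ∧ a = sSup S

/-- Join-irreducible elements of the lattice of closed elements. -/
def JoinIrredClosed (p : M) : Prop :=
  T.IsClosedElem p ∧ p ≠ ⊥ ∧
    ∀ a b : M, T.IsClosedElem a → T.IsClosedElem b → p = a ⊔ b → p = a ∨ p = b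

/-- Sober MT-algebras. -/
def Sober : Prop :=
  T.IsT0 ∧ ∀ p : M, T.JoinIrredClosed p → ∃ x : M, IsAtom x ∧ p = T.dia x

/-- Filters of the underlying lattice. -/
def IsFilter (F : Set M) : Prop :=
  ⊤ ∈ F ∧ (∀ a b : M, a ∈ F → a ≤ b → b ∈ F) ∧ (∀ a b : M, a ∈ F → b ∈ F → a ⊓ b ∈ F)

/-- Open filters. -/
def IsOpenFilter (F : Set M) : Prop :=
  IsFilter F ∧ ∀ a ∈ F, T.box a ∈ F

/-- Scott-open filters. -/
def IsScottOpenFilter (F : Set M) : Prop :=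
  T.IsOpenFilter F ∧
    ∀ S : Set M, (∀ s ∈ S, T.IsOpenElem s) → S.Nonempty → DirectedOn (· ≤ ·) S →
      sSup S ∈ F → ∃ s ∈ S, s ∈ F

/-- Compact elements. -/
def IsCompactElem (a : M) : Prop :=
  ∀ S : Set M, (∀ s ∈ S, T.IsOpenElem s) → a ≤ sSup S →
    ∃ t ⊆ S, t.Finite ∧ a ≤ sSup t

/-- The relation `a ◁ b`: there is a compact element between `a` and `b`. -/
def Triangle (a b : M) : Prop := ∃ k : M, T.IsCompactElem k ∧ a ≤ k ∧ k ≤ b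

/-- Locally compact MT-algebras. -/
def LocallyCompact : Prop :=
  ∀ u : M, T.IsOpenElem u → u = sSup {v : M | T.IsOpenElem v ∧ T.Triangle v u}

/-- The way-below relation in the frame of open elements. -/
def WayBelowOpen (a b : M) : Prop :=
  ∀ S : Set M, (∀ s ∈ S, T.IsOpenElem s) → b ≤ sSup S →
    ∃ t ⊆ S, t.Finite ∧ a ≤ sSup t

/-- Elements approximated from above by regular closed elements. -/
def GC (a : M) : Prop :=
  a = sInf {b : M | ∃ c : M, a ≤ T.box c ∧ b = T.dia (T.box c)}

/-- Hausdorff MT-algebras. -/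
def IsHausdorff : Prop :=
  ∀ a : M, ∃ S : Set M, (∀ b ∈ S, T.GC b) ∧ a = sSup S

/-- Regular MT-algebras. -/
def IsRegular : Prop :=
  T.IsT1 ∧ ∀ a : M, T.IsOpenElem a →
    a = sSup {b : M | T.IsOpenElem b ∧ T.dia b ≤ a}

end MTAlg

/-- The atom space of a complete Boolean algebra. -/
abbrev AtomSpace (M : Type*) [CompleteBooleanAlgebra M] : Type _ := {x : M // IsAtom x}

/-- The set of atoms below an element. -/
def eta {M : Type*} [CompleteBooleanAlgebra M] (a : M) : Set (AtomSpace M) :=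
  {x : AtomSpace M | x.1 ≤ a}

namespace MTAlg

variable {M : Type*} [CompleteBooleanAlgebra M] (T : MTAlg M)

/-- The topology on the atom space, generated by the images of open elements. -/
def atTop : TopologicalSpace (AtomSpace M) :=
  TopologicalSpace.generateFrom {U : Set (AtomSpace M) | ∃ u : M, T.IsOpenElem u ∧ U = eta u}

end MTAlg

namespace MTAlg

variable {M : Type*} [CompleteBooleanAlgebra M] {T : MTAlg M}

theorem box_mono {a b : M} (h : a ≤ b) : T.box a ≤ T.box b := by
  have h' := T.box_inf a b
  rw [inf_eq_left.mpr h] at h'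
  exact inf_eq_left.mp h'.symm

theorem isOpenElem_box (a : M) : T.IsOpenElem (T.box a) :=
  le_antisymm (T.box_le _) (T.box_idem _)

theorem IsOpenElem.inf {a b : M} (ha : T.IsOpenElem a) (hb : T.IsOpenElem b) :
    T.IsOpenElem (a ⊓ b) :=
  (T.box_inf a b).trans (congrArg₂ (· ⊓ ·) ha hb)

theorem isClosedElem_iff_isOpenElem_compl {a : M} :
    T.IsClosedElem a ↔ T.IsOpenElem aᶜ :=
  compl_eq_comm.trans eq_comm

theorem IsCompactElem.of_isClosedElem (hT : T.IsCompactElem ⊤) {a : M}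
    (ha : T.IsClosedElem a) : T.IsCompactElem a := by
  intro S hS haS
  obtain ⟨t, htS, htf, ht⟩ := hT (insert aᶜ S)
    (Set.forall_mem_insert.mpr ⟨isClosedElem_iff_isOpenElem_compl.mp ha, hS⟩) (by
      rw [sSup_insert, ← compl_sup_eq_top (x := a)]
      exact sup_le_sup_left haS _)
  refine ⟨t \ {aᶜ}, fun x hx => (htS hx.1).resolve_left hx.2, htf.sdiff, ?_⟩
  have h : ⊤ ≤ aᶜ ⊔ sSup (t \ {aᶜ}) := by
    rw [← sSup_insert, Set.insert_sdiff_singleton]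
    exact ht.trans (sSup_le_sSup (Set.subset_insert _ _))
  simpa using (codisjoint_iff_compl_le_right.mp (codisjoint_iff.mpr (top_le_iff.mp h)))

/-- Finitely many elements, each separated from `b` by an open element above `b`, are
separated from `b` simultaneously. -/
theorem exists_isOpenElem_disjoint_sSup {b : M} {t : Set M} (ht : t.Finite)
    (h : ∀ s ∈ t, ∃ u, T.IsOpenElem u ∧ b ≤ u ∧ Disjoint u s) :
    ∃ u, T.IsOpenElem u ∧ b ≤ u ∧ Disjoint u (sSup t) := by
  induction t, ht using Set.Finite.induction_on with
  | empty => exact ⟨⊤, T.box_top, le_top, by simp⟩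
  | insert _ _ ih =>
    obtain ⟨⟨u, hu, hbu, hus⟩, h⟩ := Set.forall_mem_insert.mp h
    obtain ⟨v, hv, hbv, hvt⟩ := ih h
    refine ⟨u ⊓ v, hu.inf hv, le_inf hbu hbv, ?_⟩
    rw [sSup_insert]
    exact (hus.mono_left inf_le_left).sup_right (hvt.mono_left inf_le_right)

theorem GC.exists_isOpenElem_disjoint {b k : M} (hb : T.GC b) (hk : T.IsCompactElem k)
    (h : Disjoint b k) : ∃ u, T.IsOpenElem u ∧ b ≤ u ∧ Disjoint u k := by
  obtain ⟨t, htS, htf, ht⟩ := hk {s | ∃ c, b ≤ T.box c ∧ s = T.box (T.box c)ᶜ}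
    (by rintro _ ⟨c, -, rfl⟩; exact isOpenElem_box _) (by
      refine h.symm.le_compl_right.trans (compl_le_iff_compl_le.mp ?_)
      refine (le_sInf ?_).trans hb.ge
      rintro _ ⟨c, hc, rfl⟩
      exact compl_le_compl (le_sSup ⟨c, hc, rfl⟩))
  obtain ⟨u, hu, hbu, hut⟩ := exists_isOpenElem_disjoint_sSup (T := T) (b := b) htf (by
    intro s hs
    obtain ⟨c, hc, rfl⟩ := htS hs
    exact ⟨T.box c, isOpenElem_box c, hc, disjoint_compl_right.mono_right (T.box_le _)⟩)
  exact ⟨u, hu, hbu, hut.mono_right ht⟩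

theorem IsHausdorff.isClosedElem_of_isCompactElem (hT : T.IsHausdorff) {k : M}
    (hk : T.IsCompactElem k) : T.IsClosedElem k := by
  refine isClosedElem_iff_isOpenElem_compl.mpr (le_antisymm (T.box_le _) ?_)
  obtain ⟨S, hS, hkS⟩ := hT kᶜ
  refine hkS.trans_le (sSup_le fun b hb => ?_)
  have hbk : b ≤ kᶜ := hkS ▸ le_sSup hb
  obtain ⟨u, hu, hbu, huk⟩ :=
    (hS b hb).exists_isOpenElem_disjoint hk (le_compl_iff_disjoint_right.mp hbk)
  exact hbu.trans (hu.symm.trans_le (box_mono huk.le_compl_right))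

end MTAlg

/-- In a compact Hausdorff MT-algebra the closed elements coincide with the compact
elements; in particular, in any compact MT-algebra every closed element is compact. -/
theorem closed_eq_compact_of_compact_hausdorff {M : Type*} [CompleteBooleanAlgebra M]
    (T : MTAlg M) :
    (T.IsCompactElem ⊤ → T.IsHausdorff →
      ∀ a : M, T.IsClosedElem a ↔ T.IsCompactElem a) ∧
    (T.IsCompactElem ⊤ → ∀ a : M, T.IsClosedElem a → T.IsCompactElem a) := by
  exact ⟨fun hc hH _ => ⟨.of_isClosedElem hc, hH.isClosedElem_of_isCompactElem⟩,
    fun hc _ => .of_isClosedElem hc⟩
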